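/- arXiv:2406.13601 — 2 statements merged into one kernel-verified Lean document; each statement's English description precedes it below -/
import Mathlib

section
/- Let (A, φ) be a C*-probability space with faithful tracial φ, let n ≥ 20, and let s_1, …, s_n be free standard semicircular elements of A. Then (1/n)·∑_{i=1}^n s_i² is invertible in A and its inverse satisfies ‖ n·( ∑_{i=1}^n s_i² )^{−1} − 1 ‖ ≤ 4/√n + 2/n. -/
open MeasureTheory Filter Topology

noncomputable section

/-- Wigner's semicircle law: density `(2π)⁻¹ √(4 - t²)` on `[-2, 2]`. -/
def semicircleLaw : Measure ℝ :=
  volume.withDensity fun t =>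
    ENNReal.ofReal (Set.indicator (Set.Icc (-2 : ℝ) 2)
      (fun t => (2 * Real.pi)⁻¹ * Real.sqrt (4 - t ^ 2)) t)

/-- Distribution function of a measure on `ℝ`. -/
def cdf (μ : Measure ℝ) (x : ℝ) : ℝ := (μ (Set.Iic x)).toReal

/-- Kolmogorov distance. -/
def kolDist (μ ν : Measure ℝ) : ℝ := ⨆ x : ℝ, |cdf μ x - cdf ν x|

/-- Cauchy transform. -/
def cauchyG (μ : Measure ℝ) (z : ℂ) : ℂ := ∫ t, (z - (t : ℂ))⁻¹ ∂μ

/-- Support of a measure on `ℝ`. -/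
def msupport (μ : Measure ℝ) : Set ℝ :=
  {x : ℝ | ∀ U : Set ℝ, IsOpen U → x ∈ U → 0 < μ U}

variable {A : Type*}

/-- `φ` is a state: unital and positive. -/
def IsState [Ring A] [StarRing A] [Algebra ℂ A] (φ : A →ₗ[ℂ] ℂ) : Prop :=
  φ 1 = 1 ∧ ∀ x : A, 0 ≤ (φ (star x * x)).re ∧ (φ (star x * x)).im = 0

/-- `φ` is tracial. -/
def IsTracial [Ring A] [Algebra ℂ A] (φ : A →ₗ[ℂ] ℂ) : Prop :=
  ∀ x y : A, φ (x * y) = φ (y * x)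

/-- `φ` is faithful. -/
def IsFaithful [Ring A] [StarRing A] [Algebra ℂ A] (φ : A →ₗ[ℂ] ℂ) : Prop :=
  ∀ x : A, φ (star x * x) = 0 → x = 0

/-- Freeness of a family of unital subalgebras w.r.t. `φ`. -/
def IsFreeFamily [Ring A] [Algebra ℂ A] (φ : A →ₗ[ℂ] ℂ)
    {I : Type*} (S : I → Subalgebra ℂ A) : Prop :=
  ∀ (k : ℕ) (idx : Fin (k + 1) → I),
    (∀ j : Fin k, idx j.castSucc ≠ idx j.succ) →
    ∀ x : Fin (k + 1) → A, (∀ j, x j ∈ S (idx j)) → (∀ j, φ (x j) = 0) →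
      φ (List.ofFn x).prod = 0

/-- Freeness of a family of elements: the generated unital subalgebras are free. -/
def AreFree [Ring A] [Algebra ℂ A] (φ : A →ₗ[ℂ] ℂ) {I : Type*} (X : I → A) : Prop :=
  IsFreeFamily φ fun i => Algebra.adjoin ℂ {X i}

/-- `μ` is the analytic distribution of `x`: a probability measure whose moments are the
`φ`-moments of `x`. -/
def IsDistribution [Ring A] [Algebra ℂ A] (φ : A →ₗ[ℂ] ℂ) (x : A) (μ : Measure ℝ) : Prop :=
  IsProbabilityMeasure μ ∧ ∀ k : ℕ, φ (x ^ k) = ((∫ t, t ^ k ∂μ : ℝ) : ℂ)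

/-- The Lyapunov-type fraction `L_{S,kn} = (∑_{i<n} ‖X i‖ ^ k) / B_n ^ k`. -/
def Lsn [Norm A] (X : ℕ → A) (σ : ℕ → ℝ) (k n : ℕ) : ℝ :=
  (∑ i ∈ Finset.range n, ‖X i‖ ^ k) /
    Real.sqrt (∑ i ∈ Finset.range n, σ i ^ 2) ^ k

/-- `s` is a standard semicircular element. -/
def IsStdSemicircular [Ring A] [StarRing A] [Algebra ℂ A] (φ : A →ₗ[ℂ] ℂ) (s : A) : Prop :=
  IsSelfAdjoint s ∧ ∀ k : ℕ, φ (s ^ k) = ((∫ t, t ^ k ∂semicircleLaw : ℝ) : ℂ)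

end

theorem measurable_semicircleDensity : Measurable (Set.indicator (Set.Icc (-2 : ℝ) 2)
    (fun t => (2 * Real.pi)⁻¹ * Real.sqrt (4 - t ^ 2))) :=
  Measurable.indicator (by fun_prop) measurableSet_Icc

theorem semicircleDensity_toReal_smul (f : ℝ → ℝ) :
    (fun t => (ENNReal.ofReal (Set.indicator (Set.Icc (-2 : ℝ) 2)
      (fun t => (2 * Real.pi)⁻¹ * Real.sqrt (4 - t ^ 2)) t)).toReal • f t) =
    Set.indicator (Set.Icc (-2 : ℝ) 2)
      (fun t => (2 * Real.pi)⁻¹ * Real.sqrt (4 - t ^ 2) * f t) := by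
  ext t
  by_cases ht : t ∈ Set.Icc (-2 : ℝ) 2
  · rw [Set.indicator_of_mem ht, Set.indicator_of_mem ht, ENNReal.toReal_ofReal (by positivity),
      smul_eq_mul]
  · simp [Set.indicator_of_notMem ht]

theorem Continuous.integrable_semicircleLaw {f : ℝ → ℝ} (hf : Continuous f) :
    Integrable f semicircleLaw := by
  rw [semicircleLaw, integrable_withDensity_iff_integrable_smul'
    measurable_semicircleDensity.ennreal_ofReal (by simp), semicircleDensity_toReal_smul,
    integrable_indicator_iff measurableSet_Icc]
  exact Continuous.integrableOn_Icc (by fun_prop)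

theorem integral_semicircleLaw (f : ℝ → ℝ) :
    ∫ t, f t ∂semicircleLaw =
      ∫ t in (-2 : ℝ)..2, (2 * Real.pi)⁻¹ * Real.sqrt (4 - t ^ 2) * f t := by
  rw [semicircleLaw, integral_withDensity_eq_integral_toReal_smul
    measurable_semicircleDensity.ennreal_ofReal (by simp), semicircleDensity_toReal_smul,
    integral_indicator measurableSet_Icc, integral_Icc_eq_integral_Ioc,
    intervalIntegral.integral_of_le (by norm_num)]

open Polynomial in
theorem integral_chebyshevS_semicircleLaw {k : ℕ} (hk : k ≠ 0) :
    ∫ t, (Chebyshev.S ℝ k).eval t ∂semicircleLaw = 0 := by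
  have h1 : ∫ x in (-1 : ℝ)..1,
      ((1 - x ^ 2) * (Chebyshev.S ℝ k).eval (2 * x)) * √(1 - x ^ 2)⁻¹ = 0 := by
    rw [← Chebyshev.integral_measureT
        fun x => (1 - x ^ 2) * (Chebyshev.S ℝ k).eval (2 * x),
      Chebyshev.integral_measureT_eq_integral_cos]
    have h2 : ∀ θ : ℝ, (1 - Real.cos θ ^ 2) * (Chebyshev.S ℝ k).eval (2 * Real.cos θ) =
        (Real.cos ((k : ℝ) * θ) - Real.cos (((k : ℝ) + 2) * θ)) / 2 := by
      intro θ
      have h3 := Chebyshev.S_two_mul_real_cos θ k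
      push_cast at h3
      have h4 : Real.cos ((k : ℝ) * θ) = Real.cos (((k : ℝ) + 1) * θ - θ) := by ring_nf
      have h5 : Real.cos (((k : ℝ) + 2) * θ) = Real.cos (((k : ℝ) + 1) * θ + θ) := by ring_nf
      rw [h4, h5, Real.cos_sub, Real.cos_add, ← h3, ← Real.sin_sq]
      ring
    simp_rw [h2]
    have h6 : ∀ m : ℕ, m ≠ 0 → ∫ θ in (0 : ℝ)..Real.pi, Real.cos ((m : ℝ) * θ) = 0 := by
      intro m hm
      rw [intervalIntegral.integral_comp_mul_left _ (by exact_mod_cast hm), integral_cos]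
      simp [Real.sin_nat_mul_pi]
    have h7 := h6 (k + 2) (by omega)
    push_cast at h7
    rw [intervalIntegral.integral_div, intervalIntegral.integral_sub
      (Continuous.intervalIntegrable (by fun_prop) _ _)
      (Continuous.intervalIntegrable (by fun_prop) _ _), h6 k hk, h7]
    simp
  rw [integral_semicircleLaw]
  have h8 := intervalIntegral.integral_comp_mul_left (a := -1) (b := 1)
    (fun t => (2 * Real.pi)⁻¹ * √(4 - t ^ 2) * (Chebyshev.S ℝ k).eval t) (two_ne_zero (α := ℝ))
  norm_num only [mul_one, mul_neg] at h8
  have h9 : ∀ x : ℝ, (2 * Real.pi)⁻¹ * √(4 - (2 * x) ^ 2) * (Chebyshev.S ℝ k).eval (2 * x) =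
      Real.pi⁻¹ * (((1 - x ^ 2) * (Chebyshev.S ℝ k).eval (2 * x)) * √(1 - x ^ 2)⁻¹) := by
    intro x
    have h10 : √(4 - (2 * x) ^ 2) = 2 * √(1 - x ^ 2) := by
      rw [show 4 - (2 * x) ^ 2 = 2 ^ 2 * (1 - x ^ 2) by ring, Real.sqrt_mul (by positivity),
        Real.sqrt_sq (by positivity)]
    have h11 : √(1 - x ^ 2) = (1 - x ^ 2) * √(1 - x ^ 2)⁻¹ := by
      rcases le_or_gt (1 - x ^ 2) 0 with h | h
      · rw [Real.sqrt_eq_zero_of_nonpos h, Real.sqrt_eq_zero_of_nonpos (inv_nonpos.2 h), mul_zero]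
      · rw [Real.sqrt_inv]
        have := Real.mul_self_sqrt h.le
        have := (Real.sqrt_pos.2 h).ne'
        field_simp
        linarith
    rw [h10, h11, mul_inv]
    ring
  simp_rw [h9, intervalIntegral.integral_const_mul, h1] at h8
  simpa using h8.symm

open Polynomial in
theorem IsStdSemicircular.map_aeval_chebyshevS {A : Type*} [Ring A] [StarRing A] [Algebra ℂ A]
    {φ : A →ₗ[ℂ] ℂ} {x : A} (hx : IsStdSemicircular φ x) {k : ℕ} (hk : k ≠ 0) :
    φ (aeval x (Chebyshev.S ℂ k)) = 0 := by
  have h : ∀ p : ℝ[X], φ (aeval x (p.map (algebraMap ℝ ℂ))) =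
      ((∫ t, p.eval t ∂semicircleLaw : ℝ) : ℂ) := by
    intro p
    simp only [Polynomial.aeval_eq_sum_range, eval_eq_sum_range]
    rw [integral_finsetSum _ fun i _ => Continuous.integrable_semicircleLaw (by fun_prop)]
    simp [hx.2, integral_const_mul, Polynomial.natDegree_map]
  rw [← Chebyshev.map_S (algebraMap ℝ ℂ), h, integral_chebyshevS_semicircleLaw hk]
  simp

theorem norm_le_of_moment_le {A : Type*} [CStarAlgebra A] {φ : A →ₗ[ℂ] ℂ} (hφ : IsState φ)
    (hFa : IsFaithful φ) {y : A} (hy : IsSelfAdjoint y) {r : ℝ} (hr : 0 ≤ r)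
    (h : ∀ k : ℕ, (φ (y ^ (2 * k))).re ≤ r ^ (2 * k)) : ‖y‖ ≤ r := by
  have hpos : ∀ f : ℝ → ℝ, ContinuousOn f (spectrum ℝ y) → (∀ t, 0 ≤ f t) →
      0 ≤ (φ (cfc f y)).re ∧ (φ (cfc f y) = 0 → cfc f y = 0) ∧ (φ (cfc f y)).im = 0 := by
    intro f hf h0
    set g := cfc (fun t => Real.sqrt (f t)) y with hg
    have hs : star g = g := (cfc_predicate (R := ℝ) (p := IsSelfAdjoint) _ y).star_eq
    have hc : ContinuousOn (fun t => Real.sqrt (f t)) (spectrum ℝ y) := hf.sqrt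
    have : cfc f y = star g * g := by
      rw [hs, hg, ← cfc_mul _ _ y hc hc]
      congr 1
      ext t
      exact (Real.mul_self_sqrt (h0 t)).symm
    rw [this]
    exact ⟨(hφ.2 g).1, fun h => by rw [hFa g h, mul_zero], (hφ.2 g).2⟩
  by_contra! hlt
  obtain ⟨ρ, hrρ, hlt_norm⟩ := exists_between hlt
  have hρ0 : 0 < ρ := hr.trans_lt hrρ
  set f : ℝ → ℝ := fun t => min (max (|t| - ρ) 0) 1 with hf
  have hfc : Continuous f := by fun_prop
  have hne : cfc (fun t => f t ^ 2) y ≠ 0 := by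
    intro h0
    have : Nontrivial A := ⟨1, 0, fun h10 => by simpa [h10] using hφ.1⟩
    obtain ⟨t, ht, hty⟩ : ∃ t ∈ spectrum ℝ y, |t| = ‖y‖ := by
      rcases CStarAlgebra.norm_or_neg_norm_mem_spectrum hy with h | h
      exacts [⟨_, h, by simp⟩, ⟨_, h, by simp⟩]
    have hmem := cfc_map_spectrum (R := ℝ) (fun t => f t ^ 2) y (ha := hy)
    rw [h0, spectrum.zero_eq] at hmem
    have h2 : f t ^ 2 = 0 := by
      have : f t ^ 2 ∈ ({0} : Set ℝ) := hmem ▸ Set.mem_image_of_mem _ ht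
      simpa using this
    have h3 : 0 < f t := by
      refine lt_min (lt_max_of_lt_left ?_) one_pos
      rw [hty]
      linarith
    exact h3.ne' (by simpa using h2)
  have hc := hpos (fun t => f t ^ 2) (by fun_prop) fun t => sq_nonneg _
  set c := (φ (cfc (fun t => f t ^ 2) y)).re with hcdef
  have hcpos : 0 < c := by
    refine lt_of_le_of_ne hc.1 fun h0 => hne (hc.2.1 (Complex.ext h0.symm hc.2.2))
  have hbound : ∀ k : ℕ, ρ ^ (2 * k) * c ≤ r ^ (2 * k) := by
    intro k
    have h1 := (hpos (fun t => t ^ (2 * k) - ρ ^ (2 * k) * f t ^ 2) (by fun_prop) fun t => ?_).1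
    · rw [cfc_sub _ _ y (by fun_prop) (by fun_prop), cfc_const_mul _ _ y (by fun_prop),
        cfc_pow_id y (2 * k)] at h1
      have h2 : (φ (y ^ (2 * k) - ρ ^ (2 * k) • cfc (fun t => f t ^ 2) y)).re =
          (φ (y ^ (2 * k))).re - ρ ^ (2 * k) * c := by
        rw [map_sub, ← Complex.coe_smul, map_smul]
        rw [Complex.sub_re, smul_eq_mul, Complex.re_ofReal_mul]
      linarith [h k]
    · have hft : f t ^ 2 ≤ 1 :=
        pow_le_one₀ (le_min (le_max_right _ _) zero_le_one) (min_le_right _ _)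
      rcases le_total |t| ρ with htr | htr
      · have : f t = 0 := by
          simp [hf, max_eq_right (sub_nonpos.2 htr)]
        rw [this]
        simp only [pow_mul]
        simp
        positivity
      · have : ρ ^ (2 * k) ≤ t ^ (2 * k) := by
          rw [← Even.pow_abs (even_two_mul k) t]
          gcongr
        have : ρ ^ (2 * k) * f t ^ 2 ≤ ρ ^ (2 * k) := mul_le_of_le_one_right (by positivity) hft
        simp only [sub_nonneg]
        linarith
  have hlim : Tendsto (fun k : ℕ => (r / ρ) ^ (2 * k)) atTop (𝓝 0) := by
    simp_rw [pow_mul]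
    refine tendsto_pow_atTop_nhds_zero_of_lt_one (by positivity) ?_
    have := (div_lt_one hρ0).2 hrρ
    exact pow_lt_one₀ (by positivity) this two_ne_zero
  refine absurd (ge_of_tendsto' hlim fun k => ?_) (not_le.2 hcpos)
  rw [div_pow, le_div_iff₀ (by positivity), mul_comm]
  exact hbound k

theorem norm_sum_sq_sub_le {B : Type*} [NormedRing B] [StarRing B] [CStarRing B]
    [NormedAlgebra ℂ B] [StarModule ℂ B] {l : ℕ → B}
    (hl : ∀ i j, star (l i) * l j = if i = j then 1 else 0) (n : ℕ) :
    ‖∑ i ∈ Finset.range n, (l i + star (l i)) ^ 2 - (n : B)‖ ≤ 2 * Real.sqrt n + 1 := by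
  cases subsingleton_or_nontrivial B
  · rw [Subsingleton.elim (∑ i ∈ Finset.range n, (l i + star (l i)) ^ 2 - (n : B)) 0, norm_zero]
    positivity
  set L := ∑ i ∈ Finset.range n, l i * l i with hL
  set P := ∑ i ∈ Finset.range n, l i * star (l i) with hP
  have hsum : ∑ i ∈ Finset.range n, (l i + star (l i)) ^ 2 - (n : B) = L + star L + P := by
    have : ∀ i, (l i + star (l i)) ^ 2 = l i * l i + star (l i) * star (l i) +
        l i * star (l i) + 1 := by
      intro i
      have := hl i i
      rw [if_pos rfl] at this
      rw [sq, mul_add, add_mul, add_mul, this]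
      abel
    simp_rw [this, Finset.sum_add_distrib]
    simp [hL, hP, star_sum]
  have hLL : star L * L = (n : B) := by
    have : ∀ i j, star (l i) * star (l i) * (l j * l j) = if i = j then 1 else 0 := by
      intro i j
      rw [mul_assoc, ← mul_assoc (star (l i)) (l j), hl]
      split_ifs with h
      · rw [one_mul, hl, if_pos h]
      · simp
    simp only [hL, star_sum, star_mul, Finset.sum_mul_sum, this, Finset.sum_ite_eq]
    rw [Finset.sum_congr rfl fun i hi => if_pos hi]
    simp
  have hPP : star P * P = P := by
    have : ∀ i j, l i * star (l i) * (l j * star (l j)) = if i = j then l i * star (l j) else 0 := by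
      intro i j
      rw [mul_assoc, ← mul_assoc (star (l i)) (l j), hl]
      split_ifs <;> simp
    simp only [hP, star_sum, star_mul, star_star, Finset.sum_mul_sum, this]
    simp +contextual [Finset.sum_ite_eq]
  have hLn : ‖L‖ ≤ Real.sqrt n := by
    refine Real.le_sqrt_of_sq_le ?_
    rw [sq, ← CStarRing.norm_star_mul_self, hLL]
    simpa using Nat.norm_cast_le (α := B) n
  have hPn : ‖P‖ ≤ 1 := by
    have h : ‖P‖ * ‖P‖ = ‖P‖ := by rw [← CStarRing.norm_star_mul_self, hPP]
    nlinarith [norm_nonneg P]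
  rw [hsum]
  calc ‖L + star L + P‖ ≤ ‖L‖ + ‖star L‖ + ‖P‖ := norm_add₃_le
    _ ≤ 2 * Real.sqrt n + 1 := by rw [norm_star]; linarith

theorem norm_inverse_sub_one_le {B : Type*} [NormedRing B] [NormOneClass B] [CompleteSpace B]
    {x : B} {δ : ℝ}
    (hx : ‖x - 1‖ ≤ δ) (hδ : δ ≤ 1 / 2) : IsUnit x ∧ ‖Ring.inverse x - 1‖ ≤ 2 * δ := by
  have hlt : ‖1 - x‖ < 1 := by rw [norm_sub_rev]; linarith
  have hu : IsUnit x := by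
    simpa using isUnit_one_sub_of_norm_lt_one hlt
  refine ⟨hu, ?_⟩
  set z := Ring.inverse x
  have hz : z - 1 = z * (1 - x) := by rw [mul_sub, Ring.inverse_mul_cancel x hu, mul_one]
  have h1 : ‖z - 1‖ ≤ ‖z‖ * δ := by
    rw [hz]
    refine (norm_mul_le _ _).trans ?_
    rw [norm_sub_rev] at hx
    gcongr
  have h2 : ‖z‖ ≤ ‖z - 1‖ + 1 := by
    simpa using norm_add_le (z - 1) 1
  have h3 := norm_nonneg (x - 1)
  have h4 : ‖z‖ ≤ 2 := by nlinarith [norm_nonneg z]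
  nlinarith

/-- The full Fock space over `ℓ²(ℕ)`, with orthonormal basis indexed by words in `ℕ`. -/
abbrev FockSpace : Type := lp (fun _ : List ℕ => ℂ) 2

namespace FockSpace

/-- The basis vector of a word. -/
noncomputable def basisVec (w : List ℕ) : FockSpace := lp.single 2 w 1

theorem inner_basisVec_left (w : List ℕ) (f : FockSpace) : inner ℂ (basisVec w) f = f w := by
  rw [basisVec, lp.inner_single_left]
  simp

theorem basisVec_apply (v w : List ℕ) : basisVec v w = if w = v then 1 else 0 := by
  rw [basisVec, lp.single_apply, Pi.single_apply]

theorem orthonormal_basisVec_cons (i : ℕ) : Orthonormal ℂ fun w => basisVec (i :: w) := by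
  rw [orthonormal_iff_ite]
  intro v w
  rw [inner_basisVec_left, basisVec_apply]
  simp

/-- The left creation operator of the `i`-th basis vector. -/
noncomputable def creation (i : ℕ) : FockSpace →L[ℂ] FockSpace :=
  (orthonormal_basisVec_cons i).orthogonalFamily.linearIsometry.toContinuousLinearMap

theorem creation_basisVec (i : ℕ) (w : List ℕ) :
    creation i (basisVec w) = basisVec (i :: w) := by
  simp [creation, basisVec]

theorem star_creation_basisVec_nil (i : ℕ) : star (creation i) (basisVec []) = 0 := by
  ext w
  rw [← inner_basisVec_left, ContinuousLinearMap.star_eq_adjoint,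
    ContinuousLinearMap.adjoint_inner_right, creation_basisVec, inner_basisVec_left,
    basisVec_apply]
  simp

theorem star_creation_basisVec_cons (i j : ℕ) (w : List ℕ) :
    star (creation i) (basisVec (j :: w)) = if i = j then basisVec w else 0 := by
  ext v
  rw [← inner_basisVec_left, ContinuousLinearMap.star_eq_adjoint,
    ContinuousLinearMap.adjoint_inner_right, creation_basisVec, inner_basisVec_left,
    basisVec_apply]
  split_ifs <;> simp_all [basisVec_apply]

theorem clm_ext {S T : FockSpace →L[ℂ] FockSpace}
    (h : ∀ w, S (basisVec w) = T (basisVec w)) : S = T := by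
  ext1 f
  have hf : HasSum (fun w => f w • basisVec w) f := by
    have := lp.hasSum_single (E := fun _ : List ℕ => ℂ) (p := 2) ENNReal.ofNat_ne_top f
    refine this.congr_fun ?_
    intro w
    rw [basisVec, ← lp.single_smul]
    simp
  have h1 := S.hasSum hf
  have h2 := T.hasSum hf
  simp only [map_smul, h] at h1 h2
  exact h1.unique h2

theorem star_creation_mul_creation (i j : ℕ) :
    star (creation i) * creation j = if i = j then 1 else 0 := by
  refine clm_ext fun w => ?_
  rw [mul_apply_eq_comp, creation_basisVec, star_creation_basisVec_cons]
  split_ifs <;> simp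

end FockSpace
/-- The elements of an algebra corresponding to the basis vectors of the Fock space when `s i`
plays the role of the sum of the `i`-th creation and annihilation operators. -/
def wickWord {A : Type*} [Ring A] (s : ℕ → A) : List ℕ → A
  | [] => 1
  | [i] => s i
  | i :: j :: w => s i * wickWord s (j :: w) - if i = j then wickWord s w else 0

open Polynomial in
theorem wickWord_replicate_append {A : Type*} [Ring A] [Algebra ℂ A] (s : ℕ → A) (i : ℕ)
    {w : List ℕ} (hw : w.head? ≠ some i) (k : ℕ) :
    wickWord s (List.replicate k i ++ w) = aeval (s i) (Chebyshev.S ℂ k) * wickWord s w := by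
  induction k using Nat.twoStepInduction with
  | zero => simp
  | one =>
    cases w with
    | nil => simp [wickWord]
    | cons j w =>
      have : i ≠ j := by rintro rfl; simp at hw
      simp [wickWord, this]
  | more k h0 h1 =>
    rw [List.replicate_succ, List.cons_append] at h1
    rw [List.replicate_succ, List.replicate_succ, List.cons_append, List.cons_append, wickWord,
      h0, h1, if_pos rfl]
    push_cast
    rw [Chebyshev.S_add_two]
    simp [sub_mul, mul_assoc]

theorem List.exists_eq_flatten_replicate (w : List ℕ) :
    ∃ L : List (ℕ × ℕ), (L.IsChain fun p q => p.1 ≠ q.1) ∧ (∀ p ∈ L, p.2 ≠ 0) ∧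
      w = (L.map fun p => List.replicate p.2 p.1).flatten := by
  induction w with
  | nil => exact ⟨[], by simp⟩
  | cons i w ih =>
    obtain ⟨L, hc, h0, rfl⟩ := ih
    rcases L with _ | ⟨⟨j, k⟩, L⟩
    · exact ⟨[(i, 1)], by simp⟩
    · by_cases hij : i = j
      · subst hij
        refine ⟨(i, k + 1) :: L, ?_, ?_, by simp [List.replicate_succ]⟩
        · cases L <;> simp_all
        · simpa using fun a b hab => h0 (a, b) (List.mem_cons_of_mem _ hab)
      · exact ⟨(i, 1) :: (j, k) :: L, by simp_all, by simpa using h0, by simp⟩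

open Polynomial in
theorem wickWord_flatten_replicate {A : Type*} [Ring A] [Algebra ℂ A] (s : ℕ → A)
    {L : List (ℕ × ℕ)} (hc : L.IsChain fun p q => p.1 ≠ q.1) (h0 : ∀ p ∈ L, p.2 ≠ 0) :
    wickWord s (L.map fun p => List.replicate p.2 p.1).flatten =
      (L.map fun p => aeval (s p.1) (Chebyshev.S ℂ p.2)).prod := by
  induction L with
  | nil => simp [wickWord]
  | cons p L ih =>
    rw [List.map_cons, List.flatten_cons, wickWord_replicate_append, List.map_cons, List.prod_cons,
      ih hc.tail fun q hq => h0 q (List.mem_cons_of_mem _ hq)]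
    rcases L with _ | ⟨q, L⟩
    · simp
    · have hq : q.2 ≠ 0 := h0 q (by simp)
      have hpq : p.1 ≠ q.1 := by simp_all
      obtain ⟨m, hm⟩ := Nat.exists_eq_succ_of_ne_zero hq
      simp [hm, List.replicate_succ, hpq.symm]

open Polynomial in
theorem AreFree.map_wickWord {A : Type*} [Ring A] [StarRing A] [Algebra ℂ A]
    {φ : A →ₗ[ℂ] ℂ} {s : ℕ → A} (hfree : AreFree φ s) (hsc : ∀ i, IsStdSemicircular φ (s i))
    {w : List ℕ} (hw : w ≠ []) : φ (wickWord s w) = 0 := by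
  obtain ⟨L, hc, h0, rfl⟩ := w.exists_eq_flatten_replicate
  rw [wickWord_flatten_replicate s hc h0]
  rcases L with _ | ⟨p, L⟩
  · simp at hw
  have := hfree L.length (fun j => ((p :: L).get j).1) ?_
    (fun j => aeval (s ((p :: L).get j).1) (Chebyshev.S ℂ (((p :: L).get j).2 : ℕ))) ?_ ?_
  · rw [← this]
    congr 1
    conv_lhs => rw [← List.ofFn_get (p :: L), List.map_ofFn]
    rfl
  · intro j
    exact List.isChain_iff_getElem.1 hc j (by simp)
  · intro j
    exact aeval_mem_adjoin_singleton _ _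
  · intro j
    exact (hsc _).map_aeval_chebyshevS (h0 _ (List.get_mem _ _))

theorem mul_wickWord {A : Type*} [Ring A] (s : ℕ → A) (i : ℕ) (w : List ℕ) :
    s i * wickWord s w = wickWord s (i :: w) +
      match w with
      | [] => 0
      | j :: v => if i = j then wickWord s v else 0 := by
  cases w <;> simp [wickWord]

open FockSpace in
/-- Free semicircular elements have the same joint distribution as the sums of creation and
annihilation operators in the vacuum state, applied to the centred sums of squares. -/
theorem AreFree.map_sum_sq_sub_pow {A : Type*} [Ring A] [StarRing A] [Algebra ℂ A]
    {φ : A →ₗ[ℂ] ℂ} (hφ : φ 1 = 1) {s : ℕ → A} (hfree : AreFree φ s)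
    (hsc : ∀ i, IsStdSemicircular φ (s i)) (n k : ℕ) :
    φ ((∑ i ∈ Finset.range n, s i ^ 2 - (n : A)) ^ k) =
      ((∑ i ∈ Finset.range n, (creation i + star (creation i)) ^ 2 -
        (n : FockSpace →L[ℂ] FockSpace)) ^ k) (basisVec []) [] := by
  set R : Submodule ℂ (A × FockSpace) :=
    Submodule.span ℂ (Set.range fun w => (wickWord s w, basisVec w))
  have hbasis : ∀ w, (wickWord s w, basisVec w) ∈ R := fun w =>
    Submodule.subset_span (Set.mem_range_self w)
  have hmul : ∀ i, ∀ p ∈ R, (s i * p.1, (creation i + star (creation i)) p.2) ∈ R := by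
    intro i p hp
    induction hp using Submodule.span_induction with
    | mem p hp =>
      obtain ⟨w, rfl⟩ := hp
      simp only [_root_.add_apply, mul_wickWord, creation_basisVec]
      cases w with
      | nil => simpa [star_creation_basisVec_nil] using hbasis [i]
      | cons j v =>
        rw [star_creation_basisVec_cons]
        by_cases hij : i = j
        · simpa [hij] using R.add_mem (hbasis (j :: j :: v)) (hbasis v)
        · simpa [hij] using hbasis (i :: j :: v)
    | zero => simp [← Prod.zero_eq_mk]
    | add p q _ _ hp hq => simpa [mul_add, add_add_add_comm] using R.add_mem hp hq
    | smul c p _ hp => simpa using R.smul_mem c hp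
  have hsub : ∀ p ∈ R, ((∑ i ∈ Finset.range n, s i ^ 2 - (n : A)) * p.1,
      (∑ i ∈ Finset.range n, (creation i + star (creation i)) ^ 2 -
        (n : FockSpace →L[ℂ] FockSpace)) p.2) ∈ R := by
    intro p hp
    have h1 := R.sub_mem (R.sum_mem fun i (_ : i ∈ Finset.range n) => hmul i _ (hmul i p hp))
      (R.smul_mem (n : ℂ) hp)
    convert h1 using 1
    ext1
    · simp [sub_mul, Finset.sum_mul, sq, mul_assoc, Prod.fst_sum, Nat.cast_smul_eq_nsmul]
    · simp [sq, Prod.snd_sum, Nat.cast_smul_eq_nsmul]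
  have hpow : ((∑ i ∈ Finset.range n, s i ^ 2 - (n : A)) ^ k,
      ((∑ i ∈ Finset.range n, (creation i + star (creation i)) ^ 2 -
        (n : FockSpace →L[ℂ] FockSpace)) ^ k) (basisVec [])) ∈ R := by
    induction k with
    | zero => simpa [wickWord] using hbasis []
    | succ k ih =>
      rw [pow_succ', pow_succ']
      exact hsub _ ih
  have hstate : ∀ p ∈ R, φ p.1 = p.2 [] := by
    intro p hp
    induction hp using Submodule.span_induction with
    | mem p hp =>
      obtain ⟨w, rfl⟩ := hp
      rw [basisVec_apply]
      by_cases hw : w = []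
      · simp [hw, wickWord, hφ]
      · simpa [Ne.symm hw] using hfree.map_wickWord hsc hw
    | zero => simp
    | add p q _ _ hp hq => simp [hp, hq]
    | smul c p _ hp => simp [hp]
  exact hstate _ hpow

open FockSpace in
theorem AreFree.norm_sum_sq_sub_le {A : Type*} [CStarAlgebra A] {φ : A →ₗ[ℂ] ℂ}
    (hφ : IsState φ) (hFa : IsFaithful φ) {s : ℕ → A} (hfree : AreFree φ s)
    (hsc : ∀ i, IsStdSemicircular φ (s i)) (n : ℕ) :
    ‖∑ i ∈ Finset.range n, s i ^ 2 - (n : A)‖ ≤ 2 * Real.sqrt n + 1 := by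
  refine norm_le_of_moment_le hφ hFa ?_ (by positivity) fun k => ?_
  · refine IsSelfAdjoint.sub (isSelfAdjoint_sum _ fun i _ => (hsc i).1.pow 2) (.natCast n)
  rw [hfree.map_sum_sq_sub_pow hφ.1 hsc]
  set T := ∑ i ∈ Finset.range n, (creation i + star (creation i)) ^ 2 -
    (n : FockSpace →L[ℂ] FockSpace)
  have hTn : ‖T‖ ≤ 2 * Real.sqrt n + 1 := 
    _root_.norm_sum_sq_sub_le (l := creation) star_creation_mul_creation n
  have hΩ : ‖basisVec []‖ = 1 := by
    rw [basisVec, lp.norm_single (by norm_num), norm_one]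
  have : Nontrivial FockSpace := ⟨basisVec [], 0, fun h0 => by simp [h0] at hΩ⟩
  calc ((T ^ (2 * k)) (basisVec []) []).re
      ≤ ‖(T ^ (2 * k)) (basisVec []) []‖ := Complex.re_le_norm _
    _ ≤ ‖(T ^ (2 * k)) (basisVec [])‖ := lp.norm_apply_le_norm two_ne_zero _ _
    _ ≤ ‖T ^ (2 * k)‖ := by simpa [hΩ] using (T ^ (2 * k)).le_opNorm (basisVec [])
    _ ≤ ‖T‖ ^ (2 * k) := norm_pow_le _ _
    _ ≤ _ := by gcongr

/-- Inequality (4.3): for `n ≥ 20` and free standard semicircular elements `s 0, …, s (n-1)`,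
the element `(1/n)·∑ s_i²` is invertible and `‖n·(∑ s_i²)⁻¹ - 1‖ ≤ 4/√n + 2/n`. -/
theorem stmt_15 (A : Type*) [NormedRing A] [StarRing A] [CStarRing A] [NormedAlgebra ℂ A]
    [CompleteSpace A] [StarModule ℂ A]
    (φ : A →ₗ[ℂ] ℂ) (hφ : IsState φ) (hTr : IsTracial φ) (hFa : IsFaithful φ)
    (n : ℕ) (hn : 20 ≤ n) (s : ℕ → A)
    (hfree : AreFree φ s)
    (hsc : ∀ i, IsStdSemicircular φ (s i)) :
    IsUnit (((n : ℂ))⁻¹ • (∑ i ∈ Finset.range n, s i ^ 2)) ∧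
    ‖Ring.inverse (((n : ℂ))⁻¹ • (∑ i ∈ Finset.range n, s i ^ 2)) - (1 : A)‖ ≤
      4 / Real.sqrt n + 2 / n := by
  let _ : CStarAlgebra A := { }
  have : Nontrivial A := ⟨1, 0, fun h10 => by simpa [h10] using hφ.1⟩
  have hn0 : (0 : ℝ) < n := by exact_mod_cast (by omega : 0 < n)
  have hn20 : (20 : ℝ) ≤ n := by exact_mod_cast hn
  have hsq : Real.sqrt n * Real.sqrt n = n := Real.mul_self_sqrt hn0.le
  have hs0 : 0 < Real.sqrt n := Real.sqrt_pos.2 hn0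
  have hsub : ((n : ℂ))⁻¹ • (∑ i ∈ Finset.range n, s i ^ 2) - (1 : A) =
      ((n : ℂ))⁻¹ • (∑ i ∈ Finset.range n, s i ^ 2 - (n : A)) := by
    have : (n : A) = (n : ℂ) • (1 : A) := by simp [Nat.cast_smul_eq_nsmul]
    rw [smul_sub, this, smul_smul, inv_mul_cancel₀ (by exact_mod_cast hn0.ne'), one_smul]
  have hδ : ‖((n : ℂ))⁻¹ • (∑ i ∈ Finset.range n, s i ^ 2) - (1 : A)‖ ≤
      2 / Real.sqrt n + 1 / n := by
    rw [hsub, norm_smul, norm_inv, Complex.norm_natCast]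
    have h := hfree.norm_sum_sq_sub_le hφ hFa hsc n
    calc _ ≤ (n : ℝ)⁻¹ * (2 * Real.sqrt n + 1) := by gcongr
      _ = 2 / Real.sqrt n + 1 / n := by
        have h2 : 2 / Real.sqrt n = 2 * Real.sqrt n / n := by
          rw [div_eq_div_iff hs0.ne' hn0.ne', mul_assoc, hsq]
        rw [h2]
        ring
  have hhalf : 2 / Real.sqrt n + 1 / n ≤ 1 / 2 := by
    have h1 : (4.47 : ℝ) ≤ Real.sqrt n := Real.le_sqrt_of_sq_le (by norm_num; linarith)
    have h2 : 2 / Real.sqrt n ≤ 2 / 4.47 := by gcongr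
    have h3 : 1 / (n : ℝ) ≤ 1 / 20 := by gcongr
    norm_num at h2 h3 ⊢
    linarith
  obtain ⟨hu, hb⟩ := norm_inverse_sub_one_le hδ hhalf
  refine ⟨hu, hb.trans_eq ?_⟩
  ring
end

section
/- Let (A, φ) be a C*-probability space with faithful tracial φ and let a_1, …, a_k be free self-adjoint elements of A with φ(a_i) = 0 for all i ∈ {1,…,k}. Then ‖ a_1 + ⋯ + a_k ‖ ≤ max_{i≤k} ‖a_i‖ + 2·( ∑_{i=1}^k φ(a_i²) )^{1/2}. -/
open MeasureTheory Filter Topology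

namespace FreeWords

variable {A : Type*}

/-- A word of centered letters `(i, x)`, `x ∈ S i`, with neighbouring indices distinct. -/
def IsAltWord [Ring A] [Algebra ℂ A] (φ : A →ₗ[ℂ] ℂ) {I : Type*} (S : I → Subalgebra ℂ A)
    (l : List (I × A)) : Prop :=
  l.IsChain (fun p q => p.1 ≠ q.1) ∧ ∀ p ∈ l, p.2 ∈ S p.1 ∧ φ p.2 = 0

/-- The span of the products of alternating centered words whose first index (`none` for the empty
word) lies in `T`. -/
def altSpan [Ring A] [Algebra ℂ A] (φ : A →ₗ[ℂ] ℂ) {I : Type*} (S : I → Subalgebra ℂ A)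
    (T : Set (Option I)) : Submodule ℂ A :=
  Submodule.span ℂ {x | ∃ l : List (I × A),
    IsAltWord φ S l ∧ l.head?.map Prod.fst ∈ T ∧ (l.map Prod.snd).prod = x}

section Algebra

variable [Ring A] [Algebra ℂ A] {φ : A →ₗ[ℂ] ℂ} {I : Type*} {S : I → Subalgebra ℂ A}

lemma IsAltWord.map_prod_eq_zero (hfree : IsFreeFamily φ S) {l : List (I × A)}
    (hl : IsAltWord φ S l) (hne : l ≠ []) : φ (l.map Prod.snd).prod = 0 := by
  obtain ⟨k, hk⟩ : ∃ k, l.length = k + 1 :=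
    Nat.exists_eq_succ_of_ne_zero (by simpa using hne)
  have h := hfree k (fun j => (l[j.1]'(by omega)).1) (fun j => by
      simpa using List.isChain_iff_getElem.mp hl.1 j.1 (by omega))
    (fun j => (l[j.1]'(by omega)).2) (fun j => (hl.2 _ (List.getElem_mem _)).1)
    (fun j => (hl.2 _ (List.getElem_mem _)).2)
  convert h using 3
  apply List.ext_getElem
  · simp [hk]
  · intro n h₁ h₂
    rw [List.getElem_map, List.getElem_ofFn]

lemma altSpan_mono {T T' : Set (Option I)} (h : T ⊆ T') : altSpan φ S T ≤ altSpan φ S T' :=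
  Submodule.span_mono fun _ ⟨l, hl, hT, hx⟩ => ⟨l, hl, h hT, hx⟩

lemma one_mem_altSpan {T : Set (Option I)} (h : none ∈ T) : (1 : A) ∈ altSpan φ S T :=
  Submodule.subset_span ⟨[], ⟨by simp, by simp⟩, by simpa using h, by simp⟩

lemma mul_mem_altSpan {i : I} {b u : A} (hb : b ∈ S i) (hb0 : φ b = 0)
    (hu : u ∈ altSpan φ S {some i}ᶜ) : b * u ∈ altSpan φ S {some i} := by
  refine Submodule.span_induction (p := fun u _ => b * u ∈ altSpan φ S {some i})
    ?_ (by simp) (fun x y _ _ hx hy => ?_) (fun c x _ hx => ?_) hu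
  · rintro _ ⟨l, hl, hT, rfl⟩
    refine Submodule.subset_span ⟨(i, b) :: l, ⟨?_, ?_⟩, by simp, by simp⟩
    · rw [List.isChain_cons]
      refine ⟨fun y hy h => hT ?_, hl.1⟩
      simp [Option.mem_def.mp hy, ← h]
    · intro p hp
      rcases List.mem_cons.mp hp with rfl | hp
      · exact ⟨hb, hb0⟩
      · exact hl.2 p hp
  · rw [mul_add]; exact add_mem hx hy
  · rw [mul_smul_comm]; exact Submodule.smul_mem _ _ hx

lemma IsAltWord.tail {p : I × A} {l : List (I × A)} (h : IsAltWord φ S (p :: l)) :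
    IsAltWord φ S l ∧ l.head?.map Prod.fst ∈ ({some p.1}ᶜ : Set (Option I)) := by
  have h1 := List.isChain_cons.mp h.1
  refine ⟨⟨h1.2, fun q hq => h.2 q (List.mem_cons_of_mem _ hq)⟩, ?_⟩
  rintro hq
  obtain ⟨q, hq, hqp⟩ := Option.map_eq_some_iff.mp (Set.mem_singleton_iff.mp hq)
  exact h1.1 q hq hqp.symm

lemma mul_sub_smul_mem_altSpan (hφ : φ 1 = 1) {i : I} {b u : A} (hb : b ∈ S i)
    (hu : u ∈ altSpan φ S {some i}ᶜ) : b * u - φ b • u ∈ altSpan φ S {some i} := by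
  have : b * u - φ b • u = (b - φ b • 1) * u := by simp [sub_mul]
  rw [this]
  exact mul_mem_altSpan (sub_mem hb ((S i).smul_mem (one_mem _) _)) (by simp [hφ]) hu

lemma mul_mem_altSpan_univ (hφ : φ 1 = 1) {i : I} {b w : A} (hb : b ∈ S i)
    (hw : w ∈ altSpan φ S Set.univ) : b * w ∈ altSpan φ S Set.univ := by
  have key : ∀ c ∈ S i, ∀ u ∈ altSpan φ S {some i}ᶜ, c * u ∈ altSpan φ S Set.univ := by
    intro c hc u hu
    have h := add_mem (altSpan_mono (Set.subset_univ _) (mul_sub_smul_mem_altSpan hφ hc hu))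
      (Submodule.smul_mem _ (φ c) (altSpan_mono (Set.subset_univ _) hu))
    simpa using h
  refine Submodule.span_induction (p := fun w _ => b * w ∈ altSpan φ S Set.univ)
    ?_ (by simp) (fun x y _ _ hx hy => ?_) (fun c x _ hx => ?_) hw
  · rintro _ ⟨l, hl, -, rfl⟩
    by_cases hi : l.head?.map Prod.fst = some i
    · rcases l with _ | ⟨p, l⟩
      · simp at hi
      · obtain rfl : p.1 = i := by simpa using hi
        have ht := hl.tail
        rw [List.map_cons, List.prod_cons, ← mul_assoc]
        exact key _ (mul_mem hb (hl.2 p (by simp)).1) _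
          (Submodule.subset_span ⟨l, ht.1, ht.2, rfl⟩)
    · exact key b hb _ (Submodule.subset_span ⟨l, hl, hi, rfl⟩)
  · rw [mul_add]; exact add_mem hx hy
  · rw [mul_smul_comm]; exact Submodule.smul_mem _ _ hx

lemma exists_components {w : A} (hw : w ∈ altSpan φ S Set.univ) :
    ∃ g : I → A, ∀ i, g i ∈ altSpan φ S {some i} ∧ w - g i ∈ altSpan φ S {some i}ᶜ := by
  classical
  refine Submodule.span_induction
    (p := fun w _ => ∃ g : I → A, ∀ i, g i ∈ altSpan φ S {some i} ∧
      w - g i ∈ altSpan φ S {some i}ᶜ)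
    ?_ ⟨0, by simp⟩ ?_ ?_ hw
  · rintro _ ⟨l, hl, -, rfl⟩
    refine ⟨fun i => if l.head?.map Prod.fst = some i then (l.map Prod.snd).prod else 0,
      fun i => ?_⟩
    by_cases h : l.head?.map Prod.fst = some i
    · simp only [h, if_true, sub_self, zero_mem, and_true]
      exact Submodule.subset_span ⟨l, hl, h, rfl⟩
    · simp only [h, if_false, sub_zero, zero_mem, true_and]
      exact Submodule.subset_span ⟨l, hl, h, rfl⟩
  · rintro x y - - ⟨g, hg⟩ ⟨h, hh⟩
    refine ⟨g + h, fun i => ⟨add_mem (hg i).1 (hh i).1, ?_⟩⟩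
    rw [Pi.add_apply, add_sub_add_comm]
    exact add_mem (hg i).2 (hh i).2
  · rintro c x - ⟨g, hg⟩
    refine ⟨c • g, fun i => ⟨Submodule.smul_mem _ _ (hg i).1, ?_⟩⟩
    rw [Pi.smul_apply, ← smul_sub]
    exact Submodule.smul_mem _ _ (hg i).2

variable [StarRing A] [StarModule ℂ A]

lemma map_star_mul_eq_zero_of_disjoint (hfree : IsFreeFamily φ S)
    (hφ : ∀ x, φ (star x) = star (φ x)) (hS : ∀ i, ∀ x ∈ S i, star x ∈ S i)
    {T T' : Set (Option I)} (hT : Disjoint T T') {x y : A}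
    (hx : x ∈ altSpan φ S T) (hy : y ∈ altSpan φ S T') : φ (star x * y) = 0 := by
  refine Submodule.span_induction₂ (p := fun x y _ _ => φ (star x * y) = 0)
    ?_ (by simp) (by simp) ?_ ?_ ?_ ?_ hx hy
  · rintro _ _ ⟨l, hl, hlT, rfl⟩ ⟨m, hm, hmT, rfl⟩
    have hne : l.head?.map Prod.fst ≠ m.head?.map Prod.fst := hT.ne_of_mem hlT hmT
    have hprod : star (l.map Prod.snd).prod * (m.map Prod.snd).prod =
        (((l.map fun p => (p.1, star p.2)).reverse ++ m).map Prod.snd).prod := by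
      have : ∀ l : List (I × A), star (l.map Prod.snd).prod =
          ((l.map fun p => (p.1, star p.2)).reverse.map Prod.snd).prod := by
        intro l
        induction l with
        | nil => simp
        | cons p l ih => simp [ih]
      rw [List.map_append, List.prod_append, this]
    rw [hprod]
    refine IsAltWord.map_prod_eq_zero hfree ⟨?_, ?_⟩ ?_
    · rw [List.isChain_append, List.isChain_reverse, List.isChain_map]
      refine ⟨hl.1.imp fun _ _ h => h.symm, hm.1, ?_⟩
      intro p hp q hq hpq
      apply hne
      rw [List.getLast?_reverse, List.head?_map] at hp
      obtain ⟨r, hr, rfl⟩ := Option.map_eq_some_iff.mp (Option.mem_def.mp hp)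
      rw [hr, Option.mem_def.mp hq]
      simpa using hpq
    · intro p hp
      rcases List.mem_append.mp hp with hp | hp
      · obtain ⟨r, hr, rfl⟩ := List.mem_map.mp (List.mem_reverse.mp hp)
        exact ⟨hS _ _ (hl.2 r hr).1, by simp [hφ, (hl.2 r hr).2]⟩
      · exact hm.2 p hp
    · intro h
      simp only [List.append_eq_nil_iff, List.reverse_eq_nil_iff, List.map_eq_nil_iff] at h
      exact hne (by rw [h.1, h.2])
  · intro x y z _ _ _ h₁ h₂; simp [add_mul, h₁, h₂]
  · intro x y z _ _ _ h₁ h₂; simp [mul_add, h₁, h₂]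
  · intro r x y _ _ h; simp [h]
  · intro r x y _ _ h; simp [h]

lemma map_star_mul_self_mul (hfree : IsFreeFamily φ S) (hφ1 : φ 1 = 1)
    (hφ : ∀ x, φ (star x) = star (φ x)) (hS : ∀ i, ∀ x ∈ S i, star x ∈ S i)
    {i : I} {b u : A} (hb : b ∈ S i) (hsa : IsSelfAdjoint b) (hu : u ∈ altSpan φ S {some i}ᶜ) :
    φ (star (b * u) * (b * u)) = φ (b ^ 2) * φ (star u * u) := by
  have h := map_star_mul_eq_zero_of_disjoint hfree hφ hS disjoint_compl_left hu
    (mul_sub_smul_mem_altSpan hφ1 (pow_mem hb 2) hu)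
  rw [mul_sub, map_sub, sub_eq_zero, mul_smul_comm, map_smul, smul_eq_mul] at h
  rw [← h, star_mul, hsa.star_eq]
  simp only [pow_two, mul_assoc]

end Algebra

section Hilbert

open scoped InnerProductSpace

variable {E : Type*} [SeminormedAddCommGroup E] [InnerProductSpace ℂ E]

lemma norm_sub_le_of_inner_eq_zero {w g : E} (h : ⟪g, w - g⟫_ℂ = 0) : ‖w - g‖ ≤ ‖w‖ := by
  have := norm_add_sq_eq_norm_sq_add_norm_sq_of_inner_eq_zero g (w - g) h
  rw [add_sub_cancel] at this
  nlinarith [norm_nonneg w, norm_nonneg (w - g), norm_nonneg g]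

lemma sum_sq_norm_le {I : Type*} [Fintype I] {w : E} {g : I → E}
    (h : ∀ i, ⟪g i, w - g i⟫_ℂ = 0) (ho : ∀ i j, i ≠ j → ⟪g i, g j⟫_ℂ = 0) :
    ∑ i, ‖g i‖ ^ 2 ≤ ‖w‖ ^ 2 := by
  classical
  have h1 : ⟪∑ i, g i, w - ∑ i, g i⟫_ℂ = 0 := by
    rw [sum_inner]
    refine Finset.sum_eq_zero fun i _ => ?_
    have h2 := h i
    rw [inner_sub_right] at h2 ⊢
    rw [inner_sum, Finset.sum_eq_single i (fun j _ hj => ho i j hj.symm) (by simp), h2]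
  have h3 := norm_add_sq_eq_norm_sq_add_norm_sq_of_inner_eq_zero _ _ h1
  have h4 : ‖∑ i, g i‖ ^ 2 = ∑ i, ‖g i‖ ^ 2 := by
    have : ((‖∑ i, g i‖ ^ 2 : ℝ) : ℂ) = ((∑ i, ‖g i‖ ^ 2 : ℝ) : ℂ) := by
      push_cast
      refine (inner_self_eq_norm_sq_to_K (𝕜 := ℂ) _).symm.trans ?_
      rw [sum_inner]
      refine Finset.sum_congr rfl fun i _ => ?_
      rw [inner_sum, Finset.sum_eq_single i (fun j _ hj => ho i j hj.symm) (by simp)]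
      exact inner_self_eq_norm_sq_to_K (𝕜 := ℂ) _
    exact_mod_cast this
  rw [add_sub_cancel] at h3
  nlinarith [norm_nonneg (w - ∑ i, g i)]

/-- The estimate for a sum of symmetric operators `T i` each of which is, with respect to the
decompositions `w = g i + (w - g i)` and `v = h i + (v - h i)`, bounded by `M` in the upper left
corner, by `s i` off the diagonal, and zero in the lower right corner. -/
lemma norm_inner_sum_le {I : Type*} [Fintype I] (T : I → E →ₗ[ℂ] E)
    (hsymm : ∀ i, (T i).IsSymmetric) {M : ℝ} (hM0 : 0 ≤ M) (hM : ∀ i x, ‖T i x‖ ≤ M * ‖x‖)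
    {s : I → ℝ} {w v : E} {g h : I → E}
    (hg : ∀ i, ⟪g i, w - g i⟫_ℂ = 0) (hgo : ∀ i j, i ≠ j → ⟪g i, g j⟫_ℂ = 0)
    (hh : ∀ i, ⟪h i, v - h i⟫_ℂ = 0) (hho : ∀ i j, i ≠ j → ⟪h i, h j⟫_ℂ = 0)
    (hs : ∀ i, 0 ≤ s i)
    (hTw : ∀ i, ‖T i (w - g i)‖ = s i * ‖w - g i‖) (hTv : ∀ i, ‖T i (v - h i)‖ = s i * ‖v - h i‖)
    (hzero : ∀ i, ⟪T i (w - g i), v - h i⟫_ℂ = 0) :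
    ‖⟪∑ i, T i w, v⟫_ℂ‖ ≤ (M + 2 * √(∑ i, s i ^ 2)) * ‖w‖ * ‖v‖ := by
  have hG := sum_sq_norm_le hg hgo
  have hH := sum_sq_norm_le hh hho
  have hG' : √(∑ i, ‖g i‖ ^ 2) ≤ ‖w‖ := Real.sqrt_le_left (norm_nonneg _) |>.mpr hG
  have hH' : √(∑ i, ‖h i‖ ^ 2) ≤ ‖v‖ := Real.sqrt_le_left (norm_nonneg _) |>.mpr hH
  have hterm : ∀ i, ‖⟪T i w, v⟫_ℂ‖ ≤
      M * (‖g i‖ * ‖h i‖) + ‖w‖ * (s i * ‖h i‖) + ‖v‖ * (s i * ‖g i‖) := by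
    intro i
    have hdec : ⟪T i w, v⟫_ℂ =
        ⟪T i (g i), h i⟫_ℂ + ⟪T i (w - g i), h i⟫_ℂ + ⟪g i, T i (v - h i)⟫_ℂ := by
      rw [← hsymm i (g i) (v - h i)]
      have hz := hzero i
      simp only [map_sub, inner_sub_left, inner_sub_right] at hz ⊢
      linear_combination hz
    rw [hdec]
    refine (norm_add₃_le).trans ?_
    gcongr
    · calc _ ≤ ‖T i (g i)‖ * ‖h i‖ := norm_inner_le_norm _ _
        _ ≤ M * ‖g i‖ * ‖h i‖ := by gcongr; exact hM i _
        _ = _ := by ring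
    · calc _ ≤ ‖T i (w - g i)‖ * ‖h i‖ := norm_inner_le_norm _ _
        _ = s i * ‖w - g i‖ * ‖h i‖ := by rw [hTw]
        _ ≤ s i * ‖w‖ * ‖h i‖ := by
          gcongr
          · exact hs i
          · exact norm_sub_le_of_inner_eq_zero (hg i)
        _ = _ := by ring
    · calc _ ≤ ‖g i‖ * ‖T i (v - h i)‖ := norm_inner_le_norm _ _
        _ = ‖g i‖ * (s i * ‖v - h i‖) := by rw [hTv]
        _ ≤ ‖g i‖ * (s i * ‖v‖) := by
          gcongr
          · exact hs i
          · exact norm_sub_le_of_inner_eq_zero (hh i)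
        _ = _ := by ring
  calc ‖⟪∑ i, T i w, v⟫_ℂ‖ ≤ ∑ i, ‖⟪T i w, v⟫_ℂ‖ := by rw [sum_inner]; exact norm_sum_le _ _
    _ ≤ ∑ i, (M * (‖g i‖ * ‖h i‖) + ‖w‖ * (s i * ‖h i‖) + ‖v‖ * (s i * ‖g i‖)) :=
        Finset.sum_le_sum fun i _ => hterm i
    _ = M * ∑ i, ‖g i‖ * ‖h i‖ + ‖w‖ * ∑ i, s i * ‖h i‖ + ‖v‖ * ∑ i, s i * ‖g i‖ := by
        simp only [Finset.sum_add_distrib, Finset.mul_sum]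
    _ ≤ M * (‖w‖ * ‖v‖) + ‖w‖ * (√(∑ i, s i ^ 2) * ‖v‖) + ‖v‖ * (√(∑ i, s i ^ 2) * ‖w‖) := by
        gcongr
        · exact (Real.sum_mul_le_sqrt_mul_sqrt _ _ _).trans (by gcongr)
        · exact (Real.sum_mul_le_sqrt_mul_sqrt _ _ _).trans (by gcongr)
        · exact (Real.sum_mul_le_sqrt_mul_sqrt _ _ _).trans (by gcongr)
    _ = _ := by ring

end Hilbert

section CStar

open scoped InnerProductSpace ComplexOrder

variable [CStarAlgebra A] [PartialOrder A] [StarOrderedRing A]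

lemma norm_le_of_forall_moment_le (f : A →ₚ[ℂ] ℂ) (hf : ∀ x, f (star x * x) = 0 → x = 0)
    {x : A} (hx : IsSelfAdjoint x) {C : ℝ} (hC : 0 ≤ C)
    (h : ∀ n : ℕ, (f (x ^ (2 * n))).re ≤ C ^ (2 * n)) : ‖x‖ ≤ C := by
  refine le_of_forall_gt_imp_ge_of_dense fun c hc => ?_
  have hc0 : 0 < c := hC.trans_lt hc
  have hcont : Continuous fun t : ℝ => max (|t| - c) 0 := by fun_prop
  set y := cfc (fun t : ℝ => max (|t| - c) 0) x with hy
  have hysa : IsSelfAdjoint y := IsSelfAdjoint.cfc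
  have hyy : star y * y = cfc (fun t : ℝ => max (|t| - c) 0 ^ 2) x := by
    rw [hysa.star_eq, ← sq, hy, ← cfc_pow _ _ _ hcont.continuousOn]
  have hle : ∀ n : ℕ, (c ^ (2 * n) : ℝ) • (star y * y) ≤ x ^ (2 * (n + 1)) := by
    intro n
    rw [hyy, ← cfc_smul (c ^ (2 * n)) (fun t : ℝ => max (|t| - c) 0 ^ 2) x
      (hcont.pow 2).continuousOn, ← cfc_pow_id (R := ℝ) x]
    refine cfc_mono (fun t _ => ?_) (by fun_prop) (by fun_prop)
    rw [smul_eq_mul, pow_mul, pow_mul, ← sq_abs t]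
    rcases le_total (|t|) c with htc | htc
    · rw [max_eq_right (by linarith)]
      simp only [ne_eq, OfNat.ofNat_ne_zero, not_false_eq_true, zero_pow, mul_zero]
      positivity
    · rw [max_eq_left (by linarith), pow_succ _ n]
      gcongr
      linarith
  have hnn : 0 ≤ f (star y * y) := f.map_nonneg (star_mul_self_nonneg _)
  have hre : (f (star y * y)).re ≤ 0 := by
    have hb : ∀ n : ℕ, (f (star y * y)).re ≤ C ^ 2 * ((C / c) ^ 2) ^ n := by
      intro n
      have h1 := (Complex.le_def.mp (OrderHomClass.mono f (hle n))).1.trans (h (n + 1))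
      rw [← Complex.coe_smul, map_smul, smul_eq_mul, Complex.re_ofReal_mul] at h1
      have : C ^ 2 * ((C / c) ^ 2) ^ n = C ^ (2 * (n + 1)) / c ^ (2 * n) := by
        rw [← pow_mul, div_pow]; ring
      rw [this, le_div_iff₀ (by positivity)]
      linarith
    have hlim : Tendsto (fun n : ℕ => C ^ 2 * ((C / c) ^ 2) ^ n) atTop (𝓝 (C ^ 2 * 0)) := by
      refine (tendsto_pow_atTop_nhds_zero_of_lt_one (by positivity) ?_).const_mul _
      exact pow_lt_one₀ (by positivity) ((div_lt_one hc0).mpr hc) (by norm_num)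
    rw [mul_zero] at hlim
    exact ge_of_tendsto' hlim hb
  have hy0 : y = 0 := hf y (Complex.ext (le_antisymm hre (Complex.le_def.mp hnn).1)
    (Complex.le_def.mp hnn).2.symm)
  rw [← cfc_id ℝ x]
  refine norm_cfc_le hc0.le fun t ht => ?_
  have ht' := norm_apply_le_norm_cfc (fun t : ℝ => max (|t| - c) 0) x ht hcont.continuousOn
  rw [← hy, hy0, norm_zero] at ht'
  have := (le_max_left _ _).trans ((le_abs_self _).trans ht')
  simpa using this

/-- In the GNS norm, `∑ a i` is bounded by `M + 2 (∑ φ(a i ^ 2))^{1/2}` on alternating words. -/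
lemma norm_sum_mul_le (f : A →ₚ[ℂ] ℂ) (hf1 : f 1 = 1) {I : Type*} [Fintype I]
    {S : I → Subalgebra ℂ A} (hfree : IsFreeFamily f.toLinearMap S)
    (hS : ∀ i, ∀ x ∈ S i, star x ∈ S i) {a : I → A} (ha : ∀ i, a i ∈ S i)
    (hsa : ∀ i, IsSelfAdjoint (a i)) (ha0 : ∀ i, f (a i) = 0) {M : ℝ} (hM0 : 0 ≤ M)
    (hM : ∀ i, ‖a i‖ ≤ M) {w : A} (hw : w ∈ altSpan f.toLinearMap S Set.univ) :
    ‖f.toPreGNS ((∑ i, a i) * w)‖ ≤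
      (M + 2 * √(∑ i, (f (a i ^ 2)).re)) * ‖f.toPreGNS w‖ := by
  have hstar : ∀ x, f.toLinearMap (star x) = star (f.toLinearMap x) := fun x => map_star f x
  set v := (∑ i, a i) * w with hv
  have hvW : v ∈ altSpan f.toLinearMap S Set.univ := by
    rw [hv, Finset.sum_mul]
    exact sum_mem fun i _ => mul_mem_altSpan_univ hf1 (ha i) hw
  have hsq : ∀ i, 0 ≤ f (a i ^ 2) := fun i => by
    have := f.map_nonneg (star_mul_self_nonneg (a i))
    rwa [(hsa i).star_eq, ← sq] at this
  obtain ⟨g, hg⟩ := exists_components hw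
  obtain ⟨h, hh⟩ := exists_components hvW
  have horth : ∀ {T T' : Set (Option I)}, Disjoint T T' → ∀ {x y : A},
      x ∈ altSpan f.toLinearMap S T → y ∈ altSpan f.toLinearMap S T' →
      ⟪f.toPreGNS x, f.toPreGNS y⟫_ℂ = 0 := fun hT _ _ hx hy =>
    map_star_mul_eq_zero_of_disjoint hfree hstar hS hT hx hy
  have hnorm : ∀ i, ∀ u ∈ altSpan f.toLinearMap S {some i}ᶜ,
      ‖f.toPreGNS (a i * u)‖ = √(f (a i ^ 2)).re * ‖f.toPreGNS u‖ := by
    intro i u hu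
    have h1 : f (star (a i * u) * (a i * u)) = f (a i ^ 2) * f (star u * u) :=
      map_star_mul_self_mul hfree hf1 hstar hS (ha i) (hsa i) hu
    rw [f.preGNS_norm_def, f.preGNS_norm_def, f.ofPreGNS_toPreGNS, f.ofPreGNS_toPreGNS, h1,
      Complex.mul_re, ← (Complex.le_def.mp (hsq i)).2, Complex.zero_im, zero_mul, sub_zero,
      Real.sqrt_mul (Complex.le_def.mp (hsq i)).1]
  have key := norm_inner_sum_le (fun i => (f.leftMulMapPreGNS (a i)).toLinearMap)
    (fun i x y => by
      simp [f.preGNS_inner_def, (hsa i).star_eq, mul_assoc]) hM0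
    (fun i x => ((f.leftMulMapPreGNS (a i)).le_of_opNorm_le
      ((LinearMap.mkContinuous_norm_le _ (norm_nonneg _) _).trans (hM i)) x))
    (s := fun i => √(f (a i ^ 2)).re)
    (w := f.toPreGNS w) (v := f.toPreGNS v) (g := fun i => f.toPreGNS (g i))
    (h := fun i => f.toPreGNS (h i))
    (fun i => horth disjoint_compl_right (hg i).1 (hg i).2)
    (fun i j hij => horth (by simpa using hij) (hg i).1 (hg j).1)
    (fun i => horth disjoint_compl_right (hh i).1 (hh i).2)
    (fun i j hij => horth (by simpa using hij) (hh i).1 (hh j).1)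
    (fun i => Real.sqrt_nonneg _)
    (fun i => hnorm i _ (hg i).2) (fun i => hnorm i _ (hh i).2)
    (fun i => horth disjoint_compl_right (mul_mem_altSpan (ha i) (ha0 i) (hg i).2) (hh i).2)
  have hsum : ∑ i, (f.leftMulMapPreGNS (a i)).toLinearMap (f.toPreGNS w) = f.toPreGNS v := by
    rw [hv, Finset.sum_mul, map_sum]
    rfl
  have hs2 : ∀ i, √(f (a i ^ 2)).re ^ 2 = (f (a i ^ 2)).re := fun i =>
    Real.sq_sqrt (Complex.le_def.mp (hsq i)).1
  simp only [hsum, hs2] at key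
  rw [inner_self_eq_norm_sq_to_K, norm_pow, RCLike.norm_ofReal, abs_norm, sq] at key
  rcases (norm_nonneg (f.toPreGNS v)).eq_or_lt with h0 | h0
  · rw [← h0]; positivity
  · exact le_of_mul_le_mul_right key h0

lemma norm_sum_le_of_free (f : A →ₚ[ℂ] ℂ) (hf1 : f 1 = 1)
    (hf : ∀ x, f (star x * x) = 0 → x = 0) {I : Type*} [Fintype I]
    {S : I → Subalgebra ℂ A} (hfree : IsFreeFamily f.toLinearMap S)
    (hS : ∀ i, ∀ x ∈ S i, star x ∈ S i) {a : I → A} (ha : ∀ i, a i ∈ S i)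
    (hsa : ∀ i, IsSelfAdjoint (a i)) (ha0 : ∀ i, f (a i) = 0) {M : ℝ} (hM0 : 0 ≤ M)
    (hM : ∀ i, ‖a i‖ ≤ M) :
    ‖∑ i, a i‖ ≤ M + 2 * √(∑ i, (f (a i ^ 2)).re) := by
  set x := ∑ i, a i with hx
  set C := M + 2 * √(∑ i, (f (a i ^ 2)).re)
  have hC : 0 ≤ C := by positivity
  have hxsa : IsSelfAdjoint x := by
    rw [IsSelfAdjoint, hx, star_sum]
    exact Finset.sum_congr rfl fun i _ => (hsa i).star_eq
  refine norm_le_of_forall_moment_le f hf hxsa hC fun n => ?_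
  have hpow : ∀ n : ℕ, x ^ n ∈ altSpan f.toLinearMap S Set.univ ∧
      ‖f.toPreGNS (x ^ n)‖ ≤ C ^ n := by
    intro n
    induction n with
    | zero =>
      refine ⟨by simpa using one_mem_altSpan (Set.mem_univ _), ?_⟩
      simp [f.preGNS_norm_def, hf1]
    | succ n ih =>
      rw [pow_succ']
      constructor
      · rw [hx, Finset.sum_mul]
        exact sum_mem fun i _ => mul_mem_altSpan_univ hf1 (ha i) ih.1
      · refine (norm_sum_mul_le f hf1 hfree hS ha hsa ha0 hM0 hM ih.1).trans ?_
        rw [pow_succ']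
        exact mul_le_mul_of_nonneg_left ih.2 hC
  have h1 := f.preGNS_norm_sq (f.toPreGNS (x ^ n))
  rw [f.ofPreGNS_toPreGNS, (hxsa.pow n).star_eq, ← pow_add, ← two_mul] at h1
  rw [← h1, mul_comm 2 n, pow_mul, ← Complex.ofReal_pow, Complex.ofReal_re]
  exact pow_le_pow_left₀ (norm_nonneg _) (hpow n).2 2

end CStar

end FreeWords

/-- **Lemma 4.2** (Voiculescu): for free self-adjoint `a 0, …, a (k-1)` with `φ(a_i) = 0`,
`‖a_0 + ⋯ + a_{k-1}‖ ≤ max_i ‖a_i‖ + 2·(∑ φ(a_i²))^{1/2}`. -/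
theorem stmt_17 (A : Type*) [NormedRing A] [StarRing A] [CStarRing A] [NormedAlgebra ℂ A]
    [CompleteSpace A] [StarModule ℂ A]
    (φ : A →ₗ[ℂ] ℂ) (hφ : IsState φ) (hTr : IsTracial φ) (hFa : IsFaithful φ)
    (k : ℕ) (a : Fin k → A)
    (hsa : ∀ i, IsSelfAdjoint (a i)) (hfree : AreFree φ a)
    (hmean : ∀ i, φ (a i) = 0) :
    ‖∑ i, a i‖ ≤ (⨆ i, ‖a i‖) + 2 * Real.sqrt (∑ i, (φ (a i ^ 2)).re) := by
  let _ : CStarAlgebra A := { }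
  let _ : PartialOrder A := CStarAlgebra.spectralOrder A
  have : StarOrderedRing A := CStarAlgebra.spectralOrderedRing A
  open scoped ComplexOrder in
  let f : A →ₚ[ℂ] ℂ := PositiveLinearMap.mk₀ φ fun x hx => by
    obtain ⟨y, rfl⟩ := CStarAlgebra.nonneg_iff_eq_star_mul_self.mp hx
    exact Complex.le_def.mpr ⟨(hφ.2 y).1, (hφ.2 y).2.symm⟩
  refine FreeWords.norm_sum_le_of_free f hφ.1 hFa hfree ?_
    (fun i => Algebra.self_mem_adjoin_singleton ℂ (a i)) hsa hmean
    (Real.iSup_nonneg fun i => norm_nonneg _)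
    (fun i => le_ciSup (f := fun i => ‖a i‖) (Set.finite_range _).bddAbove i)
  intro i x hx
  induction hx using Algebra.adjoin_induction with
  | mem x hx =>
    obtain rfl := Set.mem_singleton_iff.mp hx
    rw [(hsa i).star_eq]
    exact Algebra.self_mem_adjoin_singleton ℂ (a i)
  | algebraMap r =>
    rw [← algebraMap_star_comm]
    exact Subalgebra.algebraMap_mem _ _
  | add x y _ _ hx hy => rw [star_add]; exact add_mem hx hy
  | mul x y _ _ hx hy => rw [star_mul]; exact mul_mem hy hx
end
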